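/- arXiv:math/9904078 — 8 statements merged into one kernel-verified Lean document; each statement's English description precedes it below -/
import Mathlib

section
/- Let (V, ω) be a finite-dimensional real symplectic vector space (ω a nondegenerate alternating bilinear form), and let S : V → V be a semisimple linear map which is infinitesimally symplectic, i.e. ω(Sv, w) + ω(v, Sw) = 0 for all v, w ∈ V. Then every S-invariant Lagrangian subspace L ⊆ V admits an S-invariant Lagrangian complement: there exists an S-invariant subspace L' ⊆ V with L ⊕ L' = V and L' equal to its own ω-orthogonal complement. -/
/-- A semisimple infinitesimally symplectic map `S` on a finite-dimensional real
symplectic vector space admits, for every `S`-invariant Lagrangian subspace `L`,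
an `S`-invariant Lagrangian complement. -/
theorem invariant_lagrangian_complement
    (V : Type*) [AddCommGroup V] [Module ℝ V] [FiniteDimensional ℝ V]
    (ω : V →ₗ[ℝ] V →ₗ[ℝ] ℝ)
    (halt : ∀ v, ω v v = 0)
    (hnd : ∀ v, (∀ w, ω v w = 0) → v = 0)
    (S : V →ₗ[ℝ] V)
    (hSss : ∀ p : Submodule ℝ V, Submodule.map S p ≤ p →
      ∃ q : Submodule ℝ V, Submodule.map S q ≤ q ∧ IsCompl p q)
    (hinf : ∀ v w, ω (S v) w + ω v (S w) = 0)
    (L : Submodule ℝ V) (hLinv : Submodule.map S L ≤ L)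
    (hLag : ∀ v, v ∈ L ↔ ∀ u ∈ L, ω u v = 0) :
    ∃ L' : Submodule ℝ V, Submodule.map S L' ≤ L' ∧ IsCompl L L' ∧
      (∀ v, v ∈ L' ↔ ∀ u ∈ L', ω u v = 0) := by
  have hskew : ∀ v w, ω v w = -ω w v := fun v w ↦ by
    have h := halt (v + w)
    simp only [map_add, LinearMap.add_apply, halt] at h
    linarith
  have hsurj : Function.Surjective ω := by
    have hinj : Function.Injective ω := (injective_iff_map_eq_zero ω).2 fun v hv ↦
      hnd v fun w ↦ by rw [hv, LinearMap.zero_apply]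
    exact (LinearMap.injective_iff_surjective_of_finrank_eq_finrank
      (Subspace.dual_finrank_eq (K := ℝ) (V := V)).symm).1 hinj
  obtain ⟨M, hMinv, hc⟩ := hSss L hLinv
  have hzero : ∀ P : Submodule ℝ V, L ⊔ P = ⊤ → ∀ l ∈ L, (∀ p ∈ P, ω l p = 0) → l = 0 := by
    intro P hP l hl hlP
    refine hnd l fun w ↦ ?_
    obtain ⟨a, ha, b, hb, rfl⟩ := Submodule.mem_sup.1 (hP ▸ Submodule.mem_top : w ∈ L ⊔ P)
    rw [map_add, (hLag a).1 ha l hl, hlP b hb, add_zero]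
  have hex : ∀ m, ∃ l ∈ L, ∀ x ∈ M, ω l x = -(1 / 2) * ω m x := by
    intro m
    obtain ⟨l, hl⟩ := hsurj
      (LinearMap.ofIsCompl hc 0 ((-(1 / 2 : ℝ)) • (ω m).comp M.subtype))
    refine ⟨l, (hLag l).2 fun u hu ↦ ?_, fun x hx ↦ ?_⟩
    · rw [hskew, hl, LinearMap.ofIsCompl_apply_left hc ⟨u, hu⟩, LinearMap.zero_apply, neg_zero]
    · rw [hl, LinearMap.ofIsCompl_apply_right hc ⟨x, hx⟩]
      rfl
  let L' : Submodule ℝ V :=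
    { carrier := {v | ∃ m ∈ M, ∃ l ∈ L, v = m + l ∧ ∀ x ∈ M, ω l x = -(1 / 2) * ω m x}
      zero_mem' := ⟨0, M.zero_mem, 0, L.zero_mem, by simp, by simp⟩
      add_mem' := by
        rintro _ _ ⟨m, hm, l, hl, rfl, h⟩ ⟨m', hm', l', hl', rfl, h'⟩
        refine ⟨m + m', M.add_mem hm hm', l + l', L.add_mem hl hl', by abel, fun x hx ↦ ?_⟩
        simp only [map_add, LinearMap.add_apply, h x hx, h' x hx]
        ring
      smul_mem' := by
        rintro c _ ⟨m, hm, l, hl, rfl, h⟩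
        refine ⟨c • m, M.smul_mem c hm, c • l, L.smul_mem c hl, smul_add c m l, fun x hx ↦ ?_⟩
        simp only [map_smul, LinearMap.smul_apply, smul_eq_mul, h x hx]
        ring }
  have hsup : L ⊔ L' = ⊤ := by
    refine eq_top_iff.2 fun v _ ↦ ?_
    obtain ⟨a, ha, m, hm, rfl⟩ :=
      Submodule.mem_sup.1 (hc.sup_eq_top ▸ Submodule.mem_top : v ∈ L ⊔ M)
    obtain ⟨l, hl, h⟩ := hex m
    exact Submodule.mem_sup.2
      ⟨a - l, L.sub_mem ha hl, m + l, ⟨m, hm, l, hl, rfl, h⟩, by abel⟩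
  have hiso : ∀ v ∈ L', ∀ u ∈ L', ω u v = 0 := by
    rintro _ ⟨m, hm, l, hl, rfl, h⟩ _ ⟨m', hm', l', hl', rfl, h'⟩
    simp only [map_add, LinearMap.add_apply]
    rw [(hLag l).1 hl l' hl', h' m hm, hskew m' l, h m' hm', hskew m m']
    ring
  refine ⟨L', ?_, ⟨disjoint_iff_inf_le.2 ?_, codisjoint_iff.2 hsup⟩,
    fun v ↦ ⟨hiso v, fun hv ↦ ?_⟩⟩
  · rintro _ ⟨_, ⟨m, hm, l, hl, rfl, h⟩, rfl⟩
    have hSM : ∀ x ∈ M, S x ∈ M := fun x hx ↦ hMinv (Submodule.mem_map_of_mem hx)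
    refine ⟨S m, hSM m hm, S l, hLinv (Submodule.mem_map_of_mem hl), map_add S m l,
      fun x hx ↦ ?_⟩
    linarith [hinf l x, hinf m x, h (S x) (hSM x hx)]
  · rintro _ ⟨hv, m, hm, l, hl, rfl, h⟩
    have hmL : m ∈ L := by simpa using L.sub_mem hv hl
    obtain rfl : m = 0 := Submodule.disjoint_def.1 hc.disjoint m hmL hm
    have hl0 : l = 0 := hzero M hc.sup_eq_top l hl fun x hx ↦ by simpa using h x hx
    simp [hl0]
  · obtain ⟨a, ha, b, hb, rfl⟩ := Submodule.mem_sup.1 (hsup ▸ Submodule.mem_top : v ∈ L ⊔ L')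
    have ha0 : a = 0 := hzero L' hsup a ha fun p hp ↦ by
      have h := hv p hp
      rw [map_add, hiso b hb p hp, add_zero] at h
      rw [hskew, h, neg_zero]
    rwa [ha0, zero_add]
end

section
/- Fix real constants I₁, I₂, κ, a and set I = I₂ − I₁. Suppose differentiable curves π = (π₁,π₂,π₃) : ℝ → ℝ³ and x = (x₁,x₂) : ℝ → ℝ² satisfy the drift equations π₁' = Iπ₂π₃ − κx₂π₃ + aπ₂, π₂' = −Iπ₁π₃ + κx₁π₃ − aπ₁, π₃' = κ(π₁x₂ − π₂x₁), x₁' = κπ₂, x₂' = −κπ₁. Then the three functions t ↦ π₁(t)² + π₂(t)² + π₃(t)², t ↦ −(x₁(t)² + x₂(t)²)/2 − π₃(t), and t ↦ (I₁/2)(π₁(t)² + π₂(t)²) + (I₂/2)π₃(t)² + κ(π₁(t)x₁(t) + π₂(t)x₂(t)) + aπ₃(t) are constant. -/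
/-- A real function whose derivative vanishes everywhere is constant. -/
theorem eq_of_forall_hasDerivAt_zero {f : ℝ → ℝ} (hf : ∀ t, HasDerivAt f 0 t) (t s : ℝ) :
    f t = f s :=
  is_const_of_deriv_eq_zero (fun u => (hf u).differentiableAt) (fun u => (hf u).deriv) t s

/-- Along solutions of the drift equations, the total angular momentum magnitude
squared, the normal-form momentum `J^nf`, and the drift Hamiltonian are conserved. -/
theorem drift_conserved_quantities
    (I₁ I₂ κ a I : ℝ) (hI : I = I₂ - I₁)
    (π₁ π₂ π₃ x₁ x₂ : ℝ → ℝ)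
    (h1 : ∀ t, HasDerivAt π₁ (I * π₂ t * π₃ t - κ * x₂ t * π₃ t + a * π₂ t) t)
    (h2 : ∀ t, HasDerivAt π₂ (-(I * π₁ t * π₃ t) + κ * x₁ t * π₃ t - a * π₁ t) t)
    (h3 : ∀ t, HasDerivAt π₃ (κ * (π₁ t * x₂ t - π₂ t * x₁ t)) t)
    (h4 : ∀ t, HasDerivAt x₁ (κ * π₂ t) t)
    (h5 : ∀ t, HasDerivAt x₂ (-(κ * π₁ t)) t) :
    (∀ t s, π₁ t ^ 2 + π₂ t ^ 2 + π₃ t ^ 2 = π₁ s ^ 2 + π₂ s ^ 2 + π₃ s ^ 2) ∧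
    (∀ t s, -(x₁ t ^ 2 + x₂ t ^ 2) / 2 - π₃ t = -(x₁ s ^ 2 + x₂ s ^ 2) / 2 - π₃ s) ∧
    (∀ t s,
      I₁ / 2 * (π₁ t ^ 2 + π₂ t ^ 2) + I₂ / 2 * π₃ t ^ 2 +
          κ * (π₁ t * x₁ t + π₂ t * x₂ t) + a * π₃ t =
        I₁ / 2 * (π₁ s ^ 2 + π₂ s ^ 2) + I₂ / 2 * π₃ s ^ 2 +
          κ * (π₁ s * x₁ s + π₂ s * x₂ s) + a * π₃ s) := by
  subst hI
  refine ⟨?_, ?_, ?_⟩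
  · refine eq_of_forall_hasDerivAt_zero
      (f := fun t => π₁ t ^ 2 + π₂ t ^ 2 + π₃ t ^ 2) fun t => ?_
    refine ((((h1 t).fun_pow 2).fun_add ((h2 t).fun_pow 2)).fun_add
      ((h3 t).fun_pow 2)).congr_deriv ?_
    push_cast
    ring
  · refine eq_of_forall_hasDerivAt_zero
      (f := fun t => -(x₁ t ^ 2 + x₂ t ^ 2) / 2 - π₃ t) fun t => ?_
    refine (((((h4 t).fun_pow 2).fun_add ((h5 t).fun_pow 2)).fun_neg.div_const 2).fun_sub
      (h3 t)).congr_deriv ?_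
    push_cast
    ring
  · refine eq_of_forall_hasDerivAt_zero
      (f := fun t => I₁ / 2 * (π₁ t ^ 2 + π₂ t ^ 2) + I₂ / 2 * π₃ t ^ 2 +
        κ * (π₁ t * x₁ t + π₂ t * x₂ t) + a * π₃ t) fun t => ?_
    refine (((((((h1 t).fun_pow 2).fun_add ((h2 t).fun_pow 2)).const_mul (I₁ / 2)).fun_add
      (((h3 t).fun_pow 2).const_mul (I₂ / 2))).fun_add
      ((((h1 t).fun_mul (h4 t)).fun_add ((h2 t).fun_mul (h5 t))).const_mul κ)).fun_add
      ((h3 t).const_mul a)).congr_deriv ?_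
    push_cast
    ring
end

section
/- Fix real constants I₁, I₂, κ, a and set I = I₂ − I₁. Suppose differentiable curves π : ℝ → ℝ³, x : ℝ → ℝ² satisfy the drift equations π₁' = Iπ₂π₃ − κx₂π₃ + aπ₂, π₂' = −Iπ₁π₃ + κx₁π₃ − aπ₁, π₃' = κ(π₁x₂ − π₂x₁), x₁' = κπ₂, x₂' = −κπ₁, and a differentiable curve A : ℝ → M₃(ℝ) satisfies A'(t) = A(t)·Ω(t)^∧, where Ω(t) = (I₁π₁(t) + κx₁(t), I₁π₂(t) + κx₂(t), I₂π₃(t) + a) and v^∧ denotes the skew-symmetric matrix with (v^∧)u = v × u. Then the total angular momentum t ↦ A(t)π(t) ∈ ℝ³ is constant. -/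
/-- For `v ∈ ℝ³`, `v^∧` is the skew-symmetric matrix with `(v^∧)u = v × u`. -/
def hatMatrix (v : Fin 3 → ℝ) : Matrix (Fin 3) (Fin 3) ℝ :=
  !![0, -v 2, v 1; v 2, 0, -v 0; -v 1, v 0, 0]

/-- Along solutions of the drift equations coupled with the attitude equation
`A' = A·Ω^∧`, the total angular momentum `A·π` is constant. -/
theorem drift_total_angular_momentum_conserved
    (I₁ I₂ κ a I : ℝ) (hI : I = I₂ - I₁)
    (π₁ π₂ π₃ x₁ x₂ : ℝ → ℝ)
    (h1 : ∀ t, HasDerivAt π₁ (I * π₂ t * π₃ t - κ * x₂ t * π₃ t + a * π₂ t) t)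
    (h2 : ∀ t, HasDerivAt π₂ (-(I * π₁ t * π₃ t) + κ * x₁ t * π₃ t - a * π₁ t) t)
    (h3 : ∀ t, HasDerivAt π₃ (κ * (π₁ t * x₂ t - π₂ t * x₁ t)) t)
    (h4 : ∀ t, HasDerivAt x₁ (κ * π₂ t) t)
    (h5 : ∀ t, HasDerivAt x₂ (-(κ * π₁ t)) t)
    (A : ℝ → Matrix (Fin 3) (Fin 3) ℝ)
    (hA : ∀ t i j, HasDerivAt (fun s => A s i j)
      ((A t * hatMatrix
        ![I₁ * π₁ t + κ * x₁ t, I₁ * π₂ t + κ * x₂ t, I₂ * π₃ t + a]) i j) t) :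
    ∀ t s, (A t).mulVec ![π₁ t, π₂ t, π₃ t] = (A s).mulVec ![π₁ s, π₂ s, π₃ s] := by
  intro t s
  ext i
  have key : ∀ r, HasDerivAt (fun r => A r i 0 * π₁ r + A r i 1 * π₂ r + A r i 2 * π₃ r) 0 r := by
    intro r
    refine ((((hA r i 0).mul (h1 r)).add ((hA r i 1).mul (h2 r))).add
      ((hA r i 2).mul (h3 r))).congr_deriv ?_
    simp [Matrix.mul_apply, Fin.sum_univ_three, hatMatrix, hI]
    ring
  have hconst := is_const_of_deriv_eq_zero (fun r => (key r).differentiableAt)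
    (fun r => (key r).deriv) t s
  simpa [Matrix.mulVec, dotProduct, Fin.sum_univ_three] using hconst
end

section
/- Let κ, a, x₁, π₁ ∈ ℝ with κ ≠ 0 and x₁ ≠ 0, and set π₃ = π₁(ax₁ − κπ₁)/(κx₁²), j₁² = π₁² + π₃², and j₂ = −x₁²/2 − π₃. Then the quartic relation (3x₁⁴ + 8j₂x₁² + 4j₂² − 4j₁²)²κ² + 4a²x₁²(x₁² + 2j₂ − 2j₁)(x₁² + 2j₂ + 2j₁) = 0 holds, where j₁ ≥ 0 is the nonnegative square root of π₁² + π₃². -/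
/-- The relative equilibria of the drift system with `π₂ = x₂ = 0`, `x₁ ≠ 0`, and
`π₃ = π₁(ax₁ − κπ₁)/(κx₁²)` satisfy the quartic relation
`(3x₁⁴ + 8j₂x₁² + 4j₂² − 4j₁²)²κ² + 4a²x₁²(x₁² + 2j₂ − 2j₁)(x₁² + 2j₂ + 2j₁) = 0`. -/
theorem drift_relative_equilibria_quartic
    (κ a x₁ π₁ π₃ j₁ j₂ : ℝ) (hκ : κ ≠ 0) (hx₁ : x₁ ≠ 0)
    (hπ₃ : π₃ = π₁ * (a * x₁ - κ * π₁) / (κ * x₁ ^ 2))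
    (hj₁ : j₁ = Real.sqrt (π₁ ^ 2 + π₃ ^ 2))
    (hj₂ : j₂ = -x₁ ^ 2 / 2 - π₃) :
    (3 * x₁ ^ 4 + 8 * j₂ * x₁ ^ 2 + 4 * j₂ ^ 2 - 4 * j₁ ^ 2) ^ 2 * κ ^ 2 +
      4 * a ^ 2 * x₁ ^ 2 * (x₁ ^ 2 + 2 * j₂ - 2 * j₁) * (x₁ ^ 2 + 2 * j₂ + 2 * j₁) = 0 := by
  have h : κ * (π₃ * x₁ ^ 2 + π₁ ^ 2) = a * x₁ * π₁ := by
    rw [hπ₃]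
    field_simp
    ring
  have hsq : j₁ ^ 2 = π₁ ^ 2 + π₃ ^ 2 := by
    rw [hj₁, Real.sq_sqrt (by positivity)]
  subst hj₂
  linear_combination 16 * (κ * (π₃ * x₁ ^ 2 + π₁ ^ 2) + a * x₁ * π₁) * h +
    (-4 * κ ^ 2 * (-4 * π₃ * x₁ ^ 2 + 4 * π₃ ^ 2 - 4 * j₁ ^ 2 - 4 * π₃ * x₁ ^ 2 - 4 * π₁ ^ 2) -
      16 * a ^ 2 * x₁ ^ 2) * hsq
end

section
/- Fix real constants I₁, I₂, κ, a and σ. Suppose differentiable curves y, α, z : ℝ → ℝ³ satisfy the reduced drift equations y' = (I₁α + κz) × y, α' = −π₃·(I₁α + κz) × y + κ z × α, z' = (κα − (I₂π₃ + a)z) × y + I₁ α × z, where π₃ denotes −(σ + |z|²/2). Then the functions t ↦ |y(t)|², t ↦ α(t)·y(t), and t ↦ z(t)·y(t) are constant; in particular the constraints |y| = 1, α·y = 0, z·y = 0 defining the reduced phase space T*S² ⊕ TS² are preserved by the flow. -/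
open Matrix

theorem HasDerivAt.dotProduct_of_apply {ι : Type*} [Fintype ι] {u v : ℝ → ι → ℝ}
    {u' v' : ι → ℝ} {t : ℝ} (hu : ∀ i, HasDerivAt (fun s => u s i) (u' i) t)
    (hv : ∀ i, HasDerivAt (fun s => v s i) (v' i) t) :
    HasDerivAt (fun s => u s ⬝ᵥ v s) (u' ⬝ᵥ v t + u t ⬝ᵥ v') t := by
  simp only [dotProduct, ← Finset.sum_add_distrib]
  exact HasDerivAt.fun_sum fun i _ => (hu i).mul (hv i)

theorem dotProduct_eq_of_hasDerivAt_apply {ι : Type*} [Fintype ι] {u v u' v' : ℝ → ι → ℝ}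
    (hu : ∀ t i, HasDerivAt (fun s => u s i) (u' t i) t)
    (hv : ∀ t i, HasDerivAt (fun s => v s i) (v' t i) t)
    (h : ∀ t, u' t ⬝ᵥ v t + u t ⬝ᵥ v' t = 0) (t s : ℝ) :
    u t ⬝ᵥ v t = u s ⬝ᵥ v s := by
  have hd t := HasDerivAt.dotProduct_of_apply (hu t) (hv t)
  exact is_const_of_deriv_eq_zero (fun t => (hd t).differentiableAt)
    (fun t => (hd t).deriv.trans (h t)) t s

/-- The reduced drift equations on `T*S² ⊕ TS²` preserve `|y|²`, `α·y` and `z·y`;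
in particular the constraints `|y| = 1`, `α·y = 0`, `z·y = 0` are preserved by the flow. -/
theorem reduced_drift_preserves_constraints
    (I₁ I₂ κ a σ : ℝ)
    (y α z : ℝ → Fin 3 → ℝ) (π₃ : ℝ → ℝ)
    (hπ₃ : ∀ t, π₃ t = -(σ + (z t ⬝ᵥ z t) / 2))
    (hy : ∀ t i, HasDerivAt (fun s => y s i)
      (crossProduct (I₁ • α t + κ • z t) (y t) i) t)
    (hα : ∀ t i, HasDerivAt (fun s => α s i)
      ((-(π₃ t) • crossProduct (I₁ • α t + κ • z t) (y t)
        + κ • crossProduct (z t) (α t)) i) t)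
    (hz : ∀ t i, HasDerivAt (fun s => z s i)
      ((crossProduct (κ • α t - (I₂ * π₃ t + a) • z t) (y t)
        + I₁ • crossProduct (α t) (z t)) i) t) :
    (∀ t s, y t ⬝ᵥ y t = y s ⬝ᵥ y s) ∧
    (∀ t s, α t ⬝ᵥ y t = α s ⬝ᵥ y s) ∧
    (∀ t s, z t ⬝ᵥ y t = z s ⬝ᵥ y s) ∧
    ((y 0 ⬝ᵥ y 0 = 1 ∧ α 0 ⬝ᵥ y 0 = 0 ∧ z 0 ⬝ᵥ y 0 = 0) →
      ∀ t, y t ⬝ᵥ y t = 1 ∧ α t ⬝ᵥ y t = 0 ∧ z t ⬝ᵥ y t = 0) := by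
  have hyy := dotProduct_eq_of_hasDerivAt_apply hy hy fun t => by
    simp only [dotProduct, Fin.sum_univ_three]
    simp [cross_apply]
    ring
  have hαy := dotProduct_eq_of_hasDerivAt_apply hα hy fun t => by
    simp only [dotProduct, Fin.sum_univ_three]
    simp [cross_apply]
    ring
  have hzy := dotProduct_eq_of_hasDerivAt_apply hz hy fun t => by
    simp only [dotProduct, Fin.sum_univ_three]
    simp [cross_apply]
    ring
  refine ⟨hyy, hαy, hzy, fun ⟨h1, h2, h3⟩ t => ?_⟩
  exact ⟨(hyy t 0).trans h1, (hαy t 0).trans h2, (hzy t 0).trans h3⟩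
end

section
/- Let j > 0. For all sufficiently small h > 0, the cubic polynomial t ↦ 8(t − j)²(t + j) − h² has exactly three real roots r₁(h) < r₂(h) < r₃(h), and as h → 0⁺ these satisfy the asymptotics r₁(h) = −j + h²/(32j²) + O(h³), r₂(h) = j − h/(4√j) + O(h²), and r₃(h) = j + h/(4√j) + O(h²). -/
open Asymptotics

/-- If `a < b < c` are roots of `8(u − 1)²(u + 1) − q`, every root is one of them. -/
lemma eq_or_eq_or_eq_of_normalized_cubic_roots {a b c q u : ℝ} (hab : a < b) (hbc : b < c)
    (ha : 8 * (a - 1) ^ 2 * (a + 1) - q = 0) (hb : 8 * (b - 1) ^ 2 * (b + 1) - q = 0)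
    (hc : 8 * (c - 1) ^ 2 * (c + 1) - q = 0) (hu : 8 * (u - 1) ^ 2 * (u + 1) - q = 0) :
    u = a ∨ u = b ∨ u = c := by
  have quotient : ∀ {x y : ℝ}, x ≠ y → 8 * (x - 1) ^ 2 * (x + 1) - q = 0 →
      8 * (y - 1) ^ 2 * (y + 1) - q = 0 → x ^ 2 + x * y + y ^ 2 - (x + y) - 1 = 0 := by
    intro x y hxy hx hy
    apply mul_left_cancel₀ (sub_ne_zero.mpr hxy)
    linear_combination (hx - hy) / 8
  have sum_eq : ∀ {z : ℝ}, z ≠ a → z ≠ b → 8 * (z - 1) ^ 2 * (z + 1) - q = 0 →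
      a + b + z - 1 = 0 := by
    intro z hza hzb hz
    apply mul_left_cancel₀ (sub_ne_zero.mpr hzb)
    linear_combination quotient hza hz ha - quotient hab.ne' hb ha
  by_cases hua : u = a
  · exact Or.inl hua
  by_cases hub : u = b
  · exact Or.inr (Or.inl hub)
  have h₁ := sum_eq hua hub hu
  have h₂ := sum_eq (hab.trans hbc).ne' hbc.ne' hc
  exact Or.inr (Or.inr (by linarith))

/-- Brackets for the three roots of `8(u − 1)²(u + 1) − k²` when `k` is small. -/
lemma exists_normalized_cubic_roots {k : ℝ} (hk : 0 < k) (hk' : k < 1 / 10) :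
    ∃ a b c : ℝ, a < b ∧ b < c ∧
      (∀ u : ℝ, 8 * (u - 1) ^ 2 * (u + 1) - k ^ 2 = 0 ↔ u = a ∨ u = b ∨ u = c) ∧
      |a - (-1 + k ^ 2 / 32)| ≤ k ^ 3 ∧ |b - (1 - k / 4)| ≤ k ^ 2 ∧
      |c - (1 + k / 4)| ≤ k ^ 2 := by
  have hcont : Continuous fun u : ℝ => 8 * (u - 1) ^ 2 * (u + 1) - k ^ 2 := by fun_prop
  have h2 : 0 < k ^ 2 := by positivity
  have h3 : 0 < k ^ 3 := by positivity
  have h2' : k ^ 2 ≤ k / 10 := by nlinarith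
  have h3' : k ^ 3 ≤ k ^ 2 / 10 := by nlinarith
  obtain ⟨a, ⟨ha₁, ha₂⟩, ha⟩ := intermediate_value_Icc
    (show -1 + k ^ 2 / 32 ≤ -1 + k ^ 2 / 32 + k ^ 3 by linarith) hcont.continuousOn
    (show (0 : ℝ) ∈ Set.Icc _ _ by
      constructor
      · have h : k ^ 2 / 32 ≤ 1 := by linarith
        nlinarith [mul_nonneg (sq_nonneg (k ^ 2 / 32)) (sub_nonneg.mpr h), sq_nonneg (k ^ 2 / 32)]
      · obtain ⟨w, hw⟩ : ∃ w, w = k ^ 2 / 32 + k ^ 3 := ⟨_, rfl⟩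
        have hw0 : 0 ≤ w := by rw [hw]; positivity
        have hw1 : w ≤ k ^ 2 * (1 / 32 + 1 / 10) := by linarith
        have hww : w ^ 2 ≤ (k ^ 2 * (1 / 32 + 1 / 10)) ^ 2 := by gcongr
        have h4 : k ^ 4 ≤ k ^ 3 / 10 := by nlinarith
        have hw3 : 0 ≤ w ^ 3 := by positivity
        rw [add_assoc, ← hw]
        nlinarith)
  obtain ⟨b, ⟨hb₁, hb₂⟩, hb⟩ := intermediate_value_Icc'
    (show 1 - k / 4 - k ^ 2 ≤ 1 - k / 4 by linarith) hcont.continuousOn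
    (show (0 : ℝ) ∈ Set.Icc _ _ by
      constructor
      · nlinarith
      · have hv : (k / 4 + k ^ 2) ^ 3 ≤ (k / 4 + k / 10) ^ 3 := by gcongr
        have h4 : 0 < k ^ 4 := by positivity
        nlinarith)
  obtain ⟨c, ⟨hc₁, hc₂⟩, hc⟩ := intermediate_value_Icc
    (show 1 + k / 4 - k ^ 2 ≤ 1 + k / 4 by linarith) hcont.continuousOn
    (show (0 : ℝ) ∈ Set.Icc _ _ by
      constructor
      · have hv : (k / 4 - k ^ 2) ^ 3 ≤ (k / 4) ^ 3 := by
          have : 0 ≤ k / 4 - k ^ 2 := by linarith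
          gcongr
          linarith
        have h4 : k ^ 4 ≤ k ^ 3 / 10 := by nlinarith
        nlinarith
      · nlinarith)
  have hab : a < b := by linarith
  have hbc : b < c := by linarith
  refine ⟨a, b, c, hab, hbc, fun u => ⟨fun hu =>
    eq_or_eq_or_eq_of_normalized_cubic_roots hab hbc ha hb hc hu, ?_⟩, ?_, ?_, ?_⟩
  · rintro (rfl | rfl | rfl) <;> assumption
  all_goals rw [abs_le]; constructor <;> linarith

/-- A bound on the root of the normalized cubic in terms of the scaled parameter gives an
asymptotic bound on the rescaled root. -/
lemma isBigO_of_scaled_bound {j d : ℝ} (hj : 0 < j) (hd : 0 < d) {n : ℕ} {r p : ℝ → ℝ}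
    (f : ℝ → ℝ) (hf : ∀ h, f h = j * (r (h / d) - p (h / d)))
    (hr : ∀ k, 0 < k → k < 1 / 10 → |r k - p k| ≤ k ^ n) :
    f =O[nhdsWithin 0 (Set.Ioi 0)] (fun h : ℝ => h ^ n) := by
  refine IsBigO.of_bound (j / d ^ n) ?_
  filter_upwards [Ioo_mem_nhdsGT (show (0 : ℝ) < d / 10 by positivity)] with h hh
  have hk : h / d < 1 / 10 := by rw [div_lt_iff₀ hd]; linarith [hh.2]
  have hb := hr (h / d) (div_pos hh.1 hd) hk
  rw [hf, Real.norm_eq_abs, Real.norm_eq_abs, abs_mul, abs_of_pos hj,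
    abs_of_pos (pow_pos hh.1 n)]
  calc j * |r (h / d) - p (h / d)| ≤ j * (h / d) ^ n := by gcongr
    _ = j / d ^ n * h ^ n := by rw [div_pow]; ring

/-- For small `h > 0` the cubic `8(t − j)²(t + j) − h²` has exactly three real roots
`r₁(h) < r₂(h) < r₃(h)`, with the asymptotics `r₁ = −j + h²/(32j²) + O(h³)`,
`r₂ = j − h/(4√j) + O(h²)`, `r₃ = j + h/(4√j) + O(h²)` as `h → 0⁺`. -/
theorem cubic_roots_asymptotics (j : ℝ) (hj : 0 < j) :
    ∃ (h₀ : ℝ) (r₁ r₂ r₃ : ℝ → ℝ), 0 < h₀ ∧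
      (∀ h : ℝ, 0 < h → h < h₀ →
        r₁ h < r₂ h ∧ r₂ h < r₃ h ∧
        (∀ t : ℝ, 8 * (t - j) ^ 2 * (t + j) - h ^ 2 = 0 ↔
          t = r₁ h ∨ t = r₂ h ∨ t = r₃ h)) ∧
      (fun h : ℝ => r₁ h - (-j + h ^ 2 / (32 * j ^ 2)))
        =O[nhdsWithin 0 (Set.Ioi 0)] (fun h : ℝ => h ^ 3) ∧
      (fun h : ℝ => r₂ h - (j - h / (4 * Real.sqrt j)))
        =O[nhdsWithin 0 (Set.Ioi 0)] (fun h : ℝ => h ^ 2) ∧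
      (fun h : ℝ => r₃ h - (j + h / (4 * Real.sqrt j)))
        =O[nhdsWithin 0 (Set.Ioi 0)] (fun h : ℝ => h ^ 2) := by
  obtain ⟨s, hs, rfl⟩ : ∃ s : ℝ, 0 < s ∧ j = s ^ 2 :=
    ⟨√j, Real.sqrt_pos.mpr hj, (Real.sq_sqrt hj.le).symm⟩
  rw [Real.sqrt_sq hs.le]
  have hd : 0 < s ^ 3 := by positivity
  choose! a b c hab hbc hroots ha hb hc using
    fun (k : ℝ) (hk : 0 < k) (hk' : k < 1 / 10) => exists_normalized_cubic_roots hk hk'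
  refine ⟨s ^ 3 / 10, fun h => s ^ 2 * a (h / s ^ 3), fun h => s ^ 2 * b (h / s ^ 3),
    fun h => s ^ 2 * c (h / s ^ 3), by positivity, ?_,
    isBigO_of_scaled_bound hj hd (p := fun k => -1 + k ^ 2 / 32) _ (fun h => ?_) ha,
    isBigO_of_scaled_bound hj hd (p := fun k => 1 - k / 4) _ (fun h => ?_) hb,
    isBigO_of_scaled_bound hj hd (p := fun k => 1 + k / 4) _ (fun h => ?_) hc⟩
  · intro h hh hh'
    have hk : 0 < h / s ^ 3 := by positivity
    have hk' : h / s ^ 3 < 1 / 10 := by rw [div_lt_iff₀ hd]; linarith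
    refine ⟨mul_lt_mul_of_pos_left (hab _ hk hk') hj, mul_lt_mul_of_pos_left (hbc _ hk hk') hj,
      fun t => ?_⟩
    obtain ⟨u, rfl⟩ : ∃ u, t = s ^ 2 * u := ⟨t / s ^ 2, by field_simp⟩
    have hscale : 8 * (s ^ 2 * u - s ^ 2) ^ 2 * (s ^ 2 * u + s ^ 2) - h ^ 2 =
        s ^ 6 * (8 * (u - 1) ^ 2 * (u + 1) - (h / s ^ 3) ^ 2) := by
      field_simp
    have hs6 : s ^ 6 ≠ 0 := by positivity
    simp only [hscale, mul_eq_zero, hs6, false_or, mul_right_inj' hj.ne', hroots _ hk hk']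
  all_goals
    field_simp
    try ring
end

section
/- Let j > 0, and for small h > 0 let r₁(h) < r₂(h) < r₃(h) be the three real roots of the cubic t ↦ 8(t − j)²(t + j) − h². Then lim_{h→0⁺} ∫_{r₁(h)}^{0} (−h·t) / ((j² − t²)·√(8(t − r₁(h))(r₂(h) − t)(r₃(h) − t))) dt = π/2. -/
/-- The inverse square root is integrable at its singularity, with the expected integral. -/
theorem intervalIntegrable_inv_sqrt_sub_and_integral {a b : ℝ} (hab : a ≤ b) :
    IntervalIntegrable (fun t => (√(t - a))⁻¹) MeasureTheory.volume a b ∧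
      ∫ t in a..b, (√(t - a))⁻¹ = 2 * √(b - a) := by
  have hcont : ContinuousOn (fun t => 2 * √(t - a)) (Set.Icc a b) := by fun_prop
  have hderiv : ∀ t ∈ Set.Ioo a b, HasDerivAt (fun t => 2 * √(t - a)) (√(t - a))⁻¹ t := by
    intro t ht
    have hpos : 0 < t - a := sub_pos.2 ht.1
    have hsqrt := (((hasDerivAt_id' t).sub_const a).sqrt hpos.ne').const_mul 2
    refine hsqrt.congr_deriv ?_
    field_simp
  have hint : IntervalIntegrable (fun t => (√(t - a))⁻¹) MeasureTheory.volume a b := by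
    apply intervalIntegral.intervalIntegrable_deriv_of_nonneg (g := fun t => 2 * √(t - a))
    · rwa [Set.uIcc_of_le hab]
    · rwa [min_eq_left hab, max_eq_right hab]
    · intro t _
      positivity
  refine ⟨hint, ?_⟩
  rw [intervalIntegral.integral_eq_sub_of_hasDerivAt_of_le hab hcont hderiv hint]
  simp

/-- Three distinct roots of `8 (t - j)² (t + j) - h²` factor the cubic. -/
theorem cubic_eq_mul_of_roots {j h a b c : ℝ} (hab : a < b) (hbc : b < c)
    (ha : 8 * (a - j) ^ 2 * (a + j) - h ^ 2 = 0)
    (hb : 8 * (b - j) ^ 2 * (b + j) - h ^ 2 = 0)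
    (hc : 8 * (c - j) ^ 2 * (c + j) - h ^ 2 = 0) :
    a + b + c = j ∧
      ∀ t, 8 * (t - a) * (b - t) * (c - t) = 8 * (t - j) ^ 2 * (t + j) - h ^ 2 := by
  have e₁ : a ^ 2 + a * b + b ^ 2 - j * (a + b) - j ^ 2 = 0 :=
    mul_left_cancel₀ (sub_ne_zero.2 hab.ne) (by linear_combination (ha - hb) / 8)
  have e₂ : b ^ 2 + b * c + c ^ 2 - j * (b + c) - j ^ 2 = 0 :=
    mul_left_cancel₀ (sub_ne_zero.2 hbc.ne) (by linear_combination (hb - hc) / 8)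
  have e₃ : a + b + c - j = 0 :=
    mul_left_cancel₀ (sub_ne_zero.2 (hab.trans hbc).ne) (by linear_combination e₁ - e₂)
  refine ⟨by linarith, fun t => ?_⟩
  obtain rfl : c = j - a - b := by linarith
  linear_combination -ha - 8 * (t - a) * e₁

/-- For small `h`, the cubic has one root in `(-j, -j/2)` and the other two exceed `j/2`. -/
theorem cubic_roots_location {j h a b c : ℝ} (hj : 0 < j) (hh : 0 < h) (hsmall : h ^ 2 < j ^ 3)
    (hab : a < b) (hbc : b < c)
    (ha : 8 * (a - j) ^ 2 * (a + j) - h ^ 2 = 0)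
    (hb : 8 * (b - j) ^ 2 * (b + j) - h ^ 2 = 0)
    (hc : 8 * (c - j) ^ 2 * (c + j) - h ^ 2 = 0) :
    -j < a ∧ a < 0 ∧ j / 2 < b := by
  obtain ⟨hsum, hfac⟩ := cubic_eq_mul_of_roots hab hbc ha hb hc
  have hout : ∀ r, 8 * (r - j) ^ 2 * (r + j) - h ^ 2 = 0 → r < -(j / 2) ∨ j / 2 < r := by
    intro r hr
    by_contra! hcon
    have h₁ : (j / 2) ^ 2 ≤ (r - j) ^ 2 := by nlinarith
    have h₂ : (j / 2) ^ 2 * (j / 2) ≤ (r - j) ^ 2 * (r + j) :=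
      mul_le_mul h₁ (by linarith) (by linarith) (by positivity)
    nlinarith
  have hlow : -j < a := by
    by_contra! hcon
    have : (a - j) ^ 2 * (a + j) ≤ 0 :=
      mul_nonpos_of_nonneg_of_nonpos (sq_nonneg _) (by linarith)
    nlinarith [pow_pos hh 2]
  have hneg : a < -(j / 2) := (hout a ha).resolve_right fun h' => by linarith
  refine ⟨hlow, by linarith, (hout b hb).resolve_left fun h' => ?_⟩
  have hc0 : 0 < c := by linarith
  have hprod : 0 < a * b * c :=
    mul_pos (mul_pos_of_neg_of_neg (by linarith) (by linarith)) hc0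
  have := hfac 0
  have : 0 < j ^ 3 := by positivity
  nlinarith

/-- The phase integral differs from `arctan (√(8j³ - h²) / h)` by `O(h)`. -/
theorem abs_phase_integral_sub_arctan_le {j h a b c : ℝ} (hj : 0 < j) (hh : 0 < h)
    (haj : -j < a) (ha0 : a < 0) (hb : j / 2 < b) (hc : j / 2 < c)
    (hfac : ∀ t, 8 * (t - a) * (b - t) * (c - t) = 8 * (t - j) ^ 2 * (t + j) - h ^ 2) :
    |(∫ t in a..0, (-h * t) / ((j ^ 2 - t ^ 2) * √(8 * (t - a) * (b - t) * (c - t)))) -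
        Real.arctan (√(8 * j ^ 3 - h ^ 2) / h)| ≤ h * (√j / j ^ 2) := by
  obtain ⟨hsint, hsval⟩ := intervalIntegrable_inv_sqrt_sub_and_integral ha0.le
  set w : ℝ → ℝ := fun t => (√(8 * (t - a) * (b - t) * (c - t)))⁻¹ with hw
  have hw0 : ∀ t, 0 ≤ w t := fun t => by positivity
  have hwle : ∀ t ∈ Set.Icc a 0, w t ≤ j⁻¹ * (√(t - a))⁻¹ := by
    rintro t ⟨hat, ht0⟩
    rcases hat.eq_or_lt with rfl | hat
    · simp [hw]
    have hta : 0 < t - a := sub_pos.2 hat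
    rw [← mul_inv]
    apply inv_anti₀ (by positivity)
    rw [Real.le_sqrt' (by positivity), mul_pow, Real.sq_sqrt hta.le]
    have h₁ : j / 2 * (j / 2) ≤ (b - t) * (c - t) :=
      mul_le_mul (by linarith) (by linarith) (by linarith) (by linarith)
    nlinarith [mul_le_mul_of_nonneg_left h₁ hta.le, mul_pos hta (pow_pos hj 2)]
  have hwint : IntervalIntegrable w MeasureTheory.volume a 0 := by
    refine (hsint.const_mul j⁻¹).mono_fun' (by fun_prop) ?_
    rw [Set.uIoc_of_le ha0.le]
    refine (MeasureTheory.ae_restrict_mem measurableSet_Ioc).mono fun t ht => ?_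
    exact (Real.norm_of_nonneg (hw0 t)).trans_le <| hwle t ⟨ht.1.le, ht.2⟩
  have hjm : ∀ t ∈ Set.Icc a 0, 0 < j - t := fun t ht => by linarith [ht.2]
  have hjp : ∀ t ∈ Set.Icc a 0, 0 < j + t := fun t ht => by linarith [ht.1]
  have hjt : ∀ t ∈ Set.Icc a 0, j ^ 2 - t ^ 2 ≠ 0 := fun t ht => by
    have := mul_pos (hjm t ht) (hjp t ht)
    nlinarith
  set F' : ℝ → ℝ := fun t => -h * (3 * t + j) / (2 * (j ^ 2 - t ^ 2)) * w t with hF'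
  set R : ℝ → ℝ := fun t => h / (2 * (j - t)) * w t with hR
  have hF'int : IntervalIntegrable F' MeasureTheory.volume a 0 := by
    refine hwint.continuousOn_mul ?_
    rw [Set.uIcc_of_le ha0.le]
    exact ContinuousOn.div (by fun_prop) (by fun_prop)
      fun t ht => mul_ne_zero two_ne_zero (hjt t ht)
  have hRint : IntervalIntegrable R MeasureTheory.volume a 0 := by
    refine hwint.continuousOn_mul ?_
    rw [Set.uIcc_of_le ha0.le]
    exact ContinuousOn.div (by fun_prop) (by fun_prop)
      fun t ht => mul_ne_zero two_ne_zero (hjm t ht).ne'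
  have hsplit : (∫ t in a..0, (-h * t) /
      ((j ^ 2 - t ^ 2) * √(8 * (t - a) * (b - t) * (c - t)))) =
        (∫ t in a..0, F' t) + ∫ t in a..0, R t := by
    rw [← intervalIntegral.integral_add hF'int hRint]
    refine intervalIntegral.integral_congr fun t ht => ?_
    rw [Set.uIcc_of_le ha0.le] at ht
    have h₁ := hjt t ht
    have h₂ := (hjm t ht).ne'
    have key : -h * t / (j ^ 2 - t ^ 2) =
        -h * (3 * t + j) / (2 * (j ^ 2 - t ^ 2)) + h / (2 * (j - t)) := by
      field_simp
      ring
    simp only [hF', hR]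
    rw [← add_mul, ← key, ← div_div, div_eq_mul_inv _ (√_)]
  have hFTC : ∫ t in a..0, F' t = Real.arctan (√(8 * j ^ 3 - h ^ 2) / h) := by
    have hderiv : ∀ t ∈ Set.Ioo a 0, HasDerivAt
        (fun t => Real.arctan (√(8 * (t - j) ^ 2 * (t + j) - h ^ 2) / h)) (F' t) t := by
      rintro t ⟨hat, ht0⟩
      have hpos : 0 < 8 * (t - j) ^ 2 * (t + j) - h ^ 2 := by
        rw [← hfac]
        exact mul_pos (mul_pos (by linarith) (by linarith)) (by linarith)
      have hpoly : HasDerivAt (fun t => 8 * (t - j) ^ 2 * (t + j) - h ^ 2)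
          (8 * (t - j) * (3 * t + j)) t := by
        refine ((((((hasDerivAt_id' t).sub_const j).fun_pow 2).const_mul 8).fun_mul
          ((hasDerivAt_id' t).add_const j)).sub_const (h ^ 2)).congr_deriv ?_
        norm_num
        ring
      refine ((hpoly.sqrt hpos.ne').div_const h).arctan.congr_deriv ?_
      have hs := (Real.sqrt_pos.2 hpos).ne'
      have h₁ := hjt t ⟨hat.le, ht0.le⟩
      have h₂ := (hjm t ⟨hat.le, ht0.le⟩).ne'
      have h₃ := (hjp t ⟨hat.le, ht0.le⟩).ne'
      have h₄ : t - j ≠ 0 := fun h' => h₂ (by linarith)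
      have h₅ : t + j ≠ 0 := by rwa [add_comm]
      have hden : 1 + (√(8 * (t - j) ^ 2 * (t + j) - h ^ 2) / h) ^ 2 =
          8 * (t - j) ^ 2 * (t + j) / h ^ 2 := by
        rw [div_pow, Real.sq_sqrt hpos.le]
        field_simp
        ring
      rw [hden]
      simp only [hF', hw, hfac]
      generalize √(8 * (t - j) ^ 2 * (t + j) - h ^ 2) = s at hs
      have h₆ : j ^ 2 - t ^ 2 = -((t - j) * (t + j)) := by ring
      rw [h₆]
      field_simp
    rw [intervalIntegral.integral_eq_sub_of_hasDerivAt_of_le ha0.le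
      (Continuous.continuousOn (by fun_prop)) hderiv hF'int]
    have h₁ : 8 * (a - j) ^ 2 * (a + j) - h ^ 2 = 0 := by
      rw [← hfac]
      ring
    have h₂ : 8 * (0 - j) ^ 2 * (0 + j) - h ^ 2 = 8 * j ^ 3 - h ^ 2 := by ring
    rw [h₁, h₂]
    simp
  have hR0 : 0 ≤ ∫ t in a..0, R t :=
    intervalIntegral.integral_nonneg ha0.le fun t ht =>
      mul_nonneg (div_nonneg hh.le (by linarith [hjm t ht])) (hw0 t)
  have hRle : ∫ t in a..0, R t ≤ h * (√j / j ^ 2) := by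
    calc ∫ t in a..0, R t
        ≤ ∫ t in a..0, h / (2 * j) * (j⁻¹ * (√(t - a))⁻¹) := by
          refine intervalIntegral.integral_mono_on ha0.le hRint
            ((hsint.const_mul _).const_mul _) fun t ht => ?_
          refine mul_le_mul ?_ (hwle t ht) (hw0 t) (by positivity)
          exact div_le_div_of_nonneg_left hh.le (by positivity) (by linarith [ht.2])
      _ = h * (√(0 - a) / j ^ 2) := by
          rw [intervalIntegral.integral_const_mul, intervalIntegral.integral_const_mul, hsval]
          field_simp
      _ ≤ h * (√j / j ^ 2) := by
          gcongr
          linarith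
  rw [hsplit, hFTC, add_sub_cancel_left, abs_of_nonneg hR0]
  exact hRle

/-- The contribution `φ₁` to the `S¹` reconstruction phase shift coming from the
left singularity of the integrand: as the homoclinic orbit is approached,
`∫_{r₁(h)}^{0} (−ht)/((j² − t²)√(8(t − r₁)(r₂ − t)(r₃ − t))) dt → π/2`. -/
theorem phase_contribution_left_singularity
    (j h₀ : ℝ) (hj : 0 < j) (hh₀ : 0 < h₀)
    (r₁ r₂ r₃ : ℝ → ℝ)
    (hroots : ∀ h : ℝ, 0 < h → h < h₀ →
      r₁ h < r₂ h ∧ r₂ h < r₃ h ∧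
      8 * (r₁ h - j) ^ 2 * (r₁ h + j) - h ^ 2 = 0 ∧
      8 * (r₂ h - j) ^ 2 * (r₂ h + j) - h ^ 2 = 0 ∧
      8 * (r₃ h - j) ^ 2 * (r₃ h + j) - h ^ 2 = 0) :
    Filter.Tendsto
      (fun h : ℝ => ∫ t in (r₁ h)..0,
        (-h * t) /
          ((j ^ 2 - t ^ 2) *
            Real.sqrt (8 * (t - r₁ h) * (r₂ h - t) * (r₃ h - t))))
      (nhdsWithin 0 (Set.Ioi 0)) (nhds (Real.pi / 2)) := by
  have hid : Filter.Tendsto (fun h : ℝ => h) (nhdsWithin 0 (Set.Ioi 0)) (nhds 0) :=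
    Filter.tendsto_id.mono_left nhdsWithin_le_nhds
  have harctan : Filter.Tendsto (fun h : ℝ => Real.arctan (√(8 * j ^ 3 - h ^ 2) / h))
      (nhdsWithin 0 (Set.Ioi 0)) (nhds (Real.pi / 2)) := by
    refine (Real.tendsto_arctan_atTop.mono_right nhdsWithin_le_nhds).comp ?_
    have hsqrt : Filter.Tendsto (fun h : ℝ => √(8 * j ^ 3 - h ^ 2))
        (nhdsWithin 0 (Set.Ioi 0)) (nhds √(8 * j ^ 3)) := by
      have hcont : Continuous fun h : ℝ => √(8 * j ^ 3 - h ^ 2) := by fun_prop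
      simpa using (hcont.tendsto 0).mono_left nhdsWithin_le_nhds
    simpa only [div_eq_mul_inv] using
      hsqrt.pos_mul_atTop (Real.sqrt_pos.2 (by positivity)) tendsto_inv_nhdsGT_zero
  have hsmall : ∀ᶠ h : ℝ in nhdsWithin 0 (Set.Ioi 0), h ^ 2 < j ^ 3 := by
    have hsq := hid.pow 2
    refine hsq.eventually_lt_const ?_
    simpa using pow_pos hj 3
  have herr := squeeze_zero_norm' (a := fun h : ℝ => h * (√j / j ^ 2)) (f := fun h : ℝ =>
      (∫ t in (r₁ h)..0, (-h * t) /
        ((j ^ 2 - t ^ 2) * √(8 * (t - r₁ h) * (r₂ h - t) * (r₃ h - t)))) -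
        Real.arctan (√(8 * j ^ 3 - h ^ 2) / h)) (t₀ := nhdsWithin 0 (Set.Ioi 0)) ?_ ?_
  · simpa using herr.add harctan
  · filter_upwards [self_mem_nhdsWithin, hid.eventually_lt_const hh₀, hsmall] with h hpos hlt hsm
    obtain ⟨h₁₂, h₂₃, e₁, e₂, e₃⟩ := hroots h hpos hlt
    obtain ⟨hl, hn, hr⟩ := cubic_roots_location hj hpos hsm h₁₂ h₂₃ e₁ e₂ e₃
    exact abs_phase_integral_sub_arctan_le hj hpos hl hn hr (hr.trans h₂₃)
      (cubic_eq_mul_of_roots h₁₂ h₂₃ e₁ e₂ e₃).2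
  · simpa using hid.mul_const (√j / j ^ 2)
end

section
/- Let j > 0, and for small h > 0 let r₁(h) < r₂(h) < r₃(h) be the three real roots of the cubic t ↦ 8(t − j)²(t + j) − h². Then lim_{h→0⁺} ∫_{0}^{r₂(h)} (−h·t) / ((j² − t²)·√(8(t − r₁(h))(r₂(h) − t)(r₃(h) − t))) dt = −π/4; consequently the total S¹ reconstruction phase shift over the loop, φ = −2(φ₁ + φ₂) with φ₁ = π/2 from the previous limit, equals −π/2 as the homoclinic orbit is approached through h > 0 (and equals +π/2 through h < 0), exhibiting a phase jump of π across the homoclinic orbit. -/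
open MeasureTheory Filter in
/-- If `k` is dominated by an integrable weight `w` and `F' = k * q₂`, then `∫ k * q₁` differs
from the increment of `F` by at most `E * D * ∫ w`, where `E` bounds `|q₁ - q₂|`. -/
lemma abs_integral_mul_sub_le {a b D E : ℝ} {k w q₁ q₂ F : ℝ → ℝ} (hab : a < b)
    (hw : IntervalIntegrable w volume a b) (hk : Measurable k)
    (hkw : ∀ t ∈ Set.Ioo a b, |k t| ≤ D * w t)
    (hF : ContinuousOn F (Set.Icc a b))
    (hF' : ∀ t ∈ Set.Ioo a b, HasDerivAt F (k t * q₂ t) t)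
    (hq₁ : ContinuousOn q₁ (Set.Icc a b)) (hq₂ : ContinuousOn q₂ (Set.Icc a b))
    (hq : ∀ t ∈ Set.Icc a b, |q₁ t - q₂ t| ≤ E) :
    |(∫ t in a..b, k t * q₁ t) - (F b - F a)| ≤ E * D * ∫ t in a..b, w t := by
  have hae : ∀ᵐ t ∂(volume : Measure ℝ), t ∈ Set.Ioc a b → t ∈ Set.Ioo a b := by
    have : ∀ᵐ t ∂(volume : Measure ℝ), t ≠ b := by
      simp [ae_iff]
    filter_upwards [this] with t ht h
    exact ⟨h.1, lt_of_le_of_ne h.2 ht⟩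
  have hki : IntervalIntegrable k volume a b := by
    refine (hw.const_mul D).mono_fun hk.aestronglyMeasurable ?_
    rw [Set.uIoc_of_le hab.le]
    refine (ae_restrict_iff' measurableSet_Ioc).2 ?_
    filter_upwards [hae] with t ht h
    exact (hkw t (ht h)).trans (le_abs_self _)
  have hu : Set.uIcc a b = Set.Icc a b := Set.uIcc_of_le hab.le
  have h1 : IntervalIntegrable (fun t => k t * q₁ t) volume a b :=
    hki.mul_continuousOn (by rwa [hu])
  have h2 : IntervalIntegrable (fun t => k t * q₂ t) volume a b :=
    hki.mul_continuousOn (by rwa [hu])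
  have hFTC := intervalIntegral.integral_eq_sub_of_hasDerivAt_of_le hab.le hF hF' h2
  rw [← hFTC, ← intervalIntegral.integral_sub h1 h2, ← intervalIntegral.integral_const_mul,
    ← Real.norm_eq_abs]
  refine intervalIntegral.norm_integral_le_of_norm_le hab.le ?_ (hw.const_mul _)
  filter_upwards [hae] with t ht h
  have h' := ht h
  have e1 := hkw t h'
  have e2 := hq t ⟨h'.1.le, h'.2.le⟩
  rw [← mul_sub, Real.norm_eq_abs, abs_mul]
  calc |k t| * |q₁ t - q₂ t| ≤ (D * w t) * E :=
        mul_le_mul e1 e2 (abs_nonneg _) ((abs_nonneg _).trans e1)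
    _ = E * D * w t := by ring

open MeasureTheory in
lemma integral_rpow_neg_half_sub_left {a b : ℝ} :
    IntervalIntegrable (fun t => (t - a) ^ (-(1 / 2) : ℝ)) volume a b ∧
      ∫ t in a..b, (t - a) ^ (-(1 / 2) : ℝ) = 2 * Real.sqrt (b - a) := by
  constructor
  · have h := (intervalIntegral.intervalIntegrable_rpow' (a := 0) (b := b - a)
      (r := -(1 / 2)) (by norm_num)).comp_sub_right a
    simpa using h
  · rw [intervalIntegral.integral_comp_sub_right (fun t => t ^ (-(1 / 2) : ℝ)),
      integral_rpow (Or.inl (by norm_num)), Real.sqrt_eq_rpow]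
    norm_num
    ring

open MeasureTheory in
lemma integral_rpow_neg_half_sub_right {a b : ℝ} :
    IntervalIntegrable (fun t => (b - t) ^ (-(1 / 2) : ℝ)) volume a b ∧
      ∫ t in a..b, (b - t) ^ (-(1 / 2) : ℝ) = 2 * Real.sqrt (b - a) := by
  constructor
  · have h := (intervalIntegral.intervalIntegrable_rpow' (a := b - a) (b := 0)
      (r := -(1 / 2)) (by norm_num)).comp_sub_left b
    simpa using h
  · rw [intervalIntegral.integral_comp_sub_left (fun t => t ^ (-(1 / 2) : ℝ)),
      integral_rpow (Or.inl (by norm_num)), Real.sqrt_eq_rpow]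
    norm_num
    ring

lemma div_sqrt_le_sqrt_mul_rpow {h p D s : ℝ} (hh : 0 ≤ h) (hp : 0 < p) (hs : 0 < s)
    (hle : h ^ 2 * s ≤ D * p) :
    |h / Real.sqrt p| ≤ Real.sqrt D * s ^ (-(1 / 2) : ℝ) := by
  have hsp := Real.sqrt_pos.2 hp
  have hss := Real.sqrt_pos.2 hs
  have hD : 0 ≤ D := by
    by_contra hD
    have : D * p < 0 := mul_neg_of_neg_of_pos (not_le.1 hD) hp
    have : 0 ≤ h ^ 2 * s := by positivity
    linarith
  rw [abs_of_nonneg (by positivity), Real.rpow_neg hs.le, ← Real.sqrt_eq_rpow,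
    ← div_eq_mul_inv, div_le_div_iff₀ hsp hss, ← Real.sqrt_mul hD]
  apply Real.le_sqrt_of_sq_le
  rw [mul_pow, Real.sq_sqrt hs.le]
  exact hle

/-- Location of the roots of `8(t - j)²(t + j) - h²`, and the factorization of that cubic. -/
lemma cubic_roots {j h a b c : ℝ} (hj : 0 < j) (hh : 0 < h) (hsmall : h ^ 2 < 3 * j ^ 3)
    (hab : a < b) (hbc : b < c)
    (ha : 8 * (a - j) ^ 2 * (a + j) - h ^ 2 = 0)
    (hb : 8 * (b - j) ^ 2 * (b + j) - h ^ 2 = 0)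
    (hc : 8 * (c - j) ^ 2 * (c + j) - h ^ 2 = 0) :
    (-j < a ∧ a < -j / 2 ∧ j / 2 < b ∧ b < j ∧ j < c ∧ c < 2 * j) ∧
      ∀ t, 8 * (t - a) * (b - t) * (c - t) = 8 * (t - j) ^ 2 * (t + j) - h ^ 2 := by
  have hh2 : 0 < h ^ 2 := by positivity
  have hj3 : 0 < j ^ 3 := by positivity
  have e1 : a ^ 2 + a * b + b ^ 2 - j * (a + b) - j ^ 2 = 0 := by
    apply mul_left_cancel₀ (sub_ne_zero.2 hab.ne)
    linear_combination (ha - hb) / 8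
  have e2 : b ^ 2 + b * c + c ^ 2 - j * (b + c) - j ^ 2 = 0 := by
    apply mul_left_cancel₀ (sub_ne_zero.2 hbc.ne)
    linear_combination (hb - hc) / 8
  have e3 : a + b + c - j = 0 := by
    apply mul_left_cancel₀ (sub_ne_zero.2 (hab.trans hbc).ne)
    linear_combination e1 - e2
  have hfac : ∀ t, 8 * (t - a) * (b - t) * (c - t) = 8 * (t - j) ^ 2 * (t + j) - h ^ 2 := by
    have hc' : c = j - a - b := by linarith
    intro t
    subst hc'
    linear_combination (8 * a - 8 * t) * e1 - ha
  refine ⟨?_, hfac⟩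
  have f1 := hfac (-j)
  have f2 := hfac (-j / 2)
  have f3 := hfac (j / 2)
  have f4 := hfac j
  have f5 := hfac (2 * j)
  have a2 : a < -j / 2 := by
    by_contra! hn
    have := mul_nonneg (mul_nonneg (sub_nonneg.2 hn) (by linarith : 0 ≤ b - -j / 2))
        (by linarith : 0 ≤ c - -j / 2)
    linarith
  have b1 : b < j := by
    by_contra! hn
    have := mul_nonneg (mul_nonneg (by linarith : 0 ≤ j - a) (sub_nonneg.2 hn))
        (by linarith : 0 ≤ c - j)
    linarith
  have c1 : j < c := by
    by_contra! hn
    have := mul_nonneg (mul_nonneg (by linarith : 0 ≤ j - a) (by linarith : 0 ≤ j - b))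
        (sub_nonneg.2 hn)
    linarith
  have b2 : j / 2 < b := by
    by_contra! hn
    have := mul_nonneg (mul_nonneg (by linarith : 0 ≤ j / 2 - a) (sub_nonneg.2 hn))
        (by linarith : 0 ≤ c - j / 2)
    linarith
  have c2 : c < 2 * j := by
    by_contra! hn
    have := mul_nonneg (mul_nonneg (by linarith : 0 ≤ 2 * j - a) (by linarith : 0 ≤ 2 * j - b))
        (sub_nonneg.2 hn)
    linarith
  have a1 : -j < a := by
    by_contra! hn
    have := mul_nonneg (mul_nonneg (sub_nonneg.2 hn) (by linarith : 0 ≤ b - -j))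
        (by linarith : 0 ≤ c - -j)
    linarith
  exact ⟨a1, a2, b2, b1, c1, c2⟩

lemma hasDerivAt_arctan_sqrt_cubic {j h t : ℝ} {p : ℝ → ℝ}
    (hp : ∀ t, p t = 8 * (t - j) ^ 2 * (t + j) - h ^ 2) (hh : 0 < h) (h1 : -j < t) (h2 : t < j)
    (hpt : 0 < p t) :
    HasDerivAt (fun t => Real.arctan (Real.sqrt (p t) / h))
      (h / Real.sqrt (p t) * ((-j - 3 * t) / (2 * (j ^ 2 - t ^ 2)))) t := by
  have hd : HasDerivAt p (8 * (t - j) * (3 * t + j)) t := by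
    have : p = fun t => 8 * (t - j) ^ 2 * (t + j) - h ^ 2 := funext hp
    rw [this]
    have h0 := ((((hasDerivAt_id t).sub_const j).pow 2).const_mul 8).mul
      ((hasDerivAt_id t).add_const j)
    refine (h0.sub_const (h ^ 2)).congr_deriv ?_
    simp only [id_eq, Nat.cast_ofNat, Pi.pow_apply]
    ring
  have hs := Real.sqrt_pos.2 hpt
  have hd2 := ((hd.sqrt hpt.ne').div_const h).arctan
  convert hd2 using 1
  have hsq : Real.sqrt (p t) ^ 2 = 8 * (t - j) ^ 2 * (t + j) - h ^ 2 := by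
    rw [Real.sq_sqrt hpt.le, hp]
  have n1 : t - j ≠ 0 := by linarith
  have n2 : t + j ≠ 0 := by linarith
  have n3 : j ^ 2 - t ^ 2 ≠ 0 := by
    have : j ^ 2 - t ^ 2 = -((t - j) * (t + j)) := by ring
    rw [this]; exact neg_ne_zero.2 (mul_ne_zero n1 n2)
  have n4 : 1 + (Real.sqrt (p t) / h) ^ 2 = 8 * (t - j) ^ 2 * (t + j) / h ^ 2 := by
    rw [div_pow, hsq]; field_simp; ring
  rw [n4]
  field_simp
  ring

/-- Quantitative form of the limit, with the leading term explicit, on a subinterval of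
`(-j, j)` where the cubic is dominated at one endpoint by the weight `w`. -/
lemma abs_phase_integral_sub_le {j h a b D E c : ℝ} {p s : ℝ → ℝ} (hh : 0 < h)
    (hp : ∀ t, p t = 8 * (t - j) ^ 2 * (t + j) - h ^ 2)
    (hja : -j < a) (hab : a < b) (hbj : b < j)
    (hpos : ∀ t ∈ Set.Ioo a b, 0 < p t) (hs : ∀ t ∈ Set.Ioo a b, 0 < s t)
    (hD : ∀ t ∈ Set.Ioo a b, h ^ 2 * s t ≤ D * p t)
    (hw : IntervalIntegrable (fun t => s t ^ (-(1 / 2) : ℝ)) MeasureTheory.volume a b)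
    (hE : ∀ t ∈ Set.Icc a b,
      |-t / (j ^ 2 - t ^ 2) - c * ((-j - 3 * t) / (2 * (j ^ 2 - t ^ 2)))| ≤ E) :
    |(∫ t in a..b, (-h * t) / ((j ^ 2 - t ^ 2) * Real.sqrt (p t))) -
        (c * Real.arctan (Real.sqrt (p b) / h) - c * Real.arctan (Real.sqrt (p a) / h))| ≤
      E * Real.sqrt D * ∫ t in a..b, s t ^ (-(1 / 2) : ℝ) := by
  have hpc : Continuous p := by
    rw [show p = fun t => 8 * (t - j) ^ 2 * (t + j) - h ^ 2 from funext hp]; fun_prop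
  have hne : ∀ t ∈ Set.Icc a b, j ^ 2 - t ^ 2 ≠ 0 := by
    intro t ht
    have := mul_pos (by linarith [ht.2] : 0 < j - t) (by linarith [ht.1] : 0 < j + t)
    nlinarith
  have heq : ∀ t, (-h * t) / ((j ^ 2 - t ^ 2) * Real.sqrt (p t)) =
      h / Real.sqrt (p t) * (-t / (j ^ 2 - t ^ 2)) := by
    intro t
    rw [div_mul_div_comm, mul_comm (Real.sqrt _)]
    congr 1
    ring
  simp only [heq]
  refine abs_integral_mul_sub_le (k := fun t => h / Real.sqrt (p t))
    (q₁ := fun t => -t / (j ^ 2 - t ^ 2))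
    (q₂ := fun t => c * ((-j - 3 * t) / (2 * (j ^ 2 - t ^ 2))))
    (F := fun t => c * Real.arctan (Real.sqrt (p t) / h)) hab hw ?_ ?_ ?_ ?_ ?_ ?_ hE
  · exact measurable_const.div hpc.measurable.sqrt
  · intro t ht
    exact div_sqrt_le_sqrt_mul_rpow hh.le (hpos t ht) (hs t ht) (hD t ht)
  · exact (continuous_const.mul
      (Real.continuous_arctan.comp (hpc.sqrt.div_const h))).continuousOn
  · intro t ht
    exact ((hasDerivAt_arctan_sqrt_cubic hp hh (by linarith [ht.1]) (by linarith [ht.2])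
      (hpos t ht)).const_mul c).congr_deriv (by ring)
  · exact ContinuousOn.div (by fun_prop) (by fun_prop) hne
  · exact continuousOn_const.mul (ContinuousOn.div (by fun_prop) (by fun_prop)
      fun t ht => mul_ne_zero two_ne_zero (hne t ht))

lemma abs_phase_right_le {j h a b c : ℝ} (hj : 0 < j) (hh : 0 < h) (hsmall : h ^ 2 < 3 * j ^ 3)
    (hab : a < b) (hbc : b < c)
    (ha : 8 * (a - j) ^ 2 * (a + j) - h ^ 2 = 0)
    (hb : 8 * (b - j) ^ 2 * (b + j) - h ^ 2 = 0)
    (hc : 8 * (c - j) ^ 2 * (c + j) - h ^ 2 = 0) :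
    |(∫ t in (0 : ℝ)..b, (-h * t) / ((j ^ 2 - t ^ 2) *
        Real.sqrt (8 * (t - a) * (b - t) * (c - t)))) -
        -(1 / 2 * Real.arctan (Real.sqrt (8 * j ^ 3 - h ^ 2) / h))| ≤
      1 / j * Real.sqrt (h * (Real.sqrt (24 * j) / (4 * j))) * (2 * Real.sqrt j) := by
  obtain ⟨⟨a1, a2, b2, b1, c1, c2⟩, hfac⟩ := cubic_roots hj hh hsmall hab hbc ha hb hc
  have hb0 : 0 < b := by linarith
  obtain ⟨hwi, hwe⟩ := integral_rpow_neg_half_sub_right (a := 0) (b := b)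
  have hhc : h ≤ Real.sqrt (24 * j) * (c - j) := by
    rw [← Real.sqrt_sq (by linarith : 0 ≤ c - j), ← Real.sqrt_mul (by linarith)]
    apply Real.le_sqrt_of_sq_le
    have := mul_nonneg (sq_nonneg (c - j)) (by linarith : 0 ≤ 2 * j - c)
    nlinarith
  have key := abs_phase_integral_sub_le (p := fun t => 8 * (t - a) * (b - t) * (c - t))
    (s := fun t => b - t) (c := 1 / 2) (E := 1 / j)
    (D := h * (Real.sqrt (24 * j) / (4 * j))) hh hfac (by linarith) hb0 b1
    (fun t ht => mul_pos (mul_pos (by linarith [ht.1]) (by linarith [ht.2]))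
      (by linarith [ht.2])) (fun t ht => by linarith [ht.2]) ?_ hwi ?_
  · have hp0 : 8 * (0 - a) * (b - 0) * (c - 0) = 8 * j ^ 3 - h ^ 2 := by
      rw [hfac]; ring
    have hpb : 8 * (b - a) * (b - b) * (c - b) = 0 := by ring
    beta_reduce at key
    rw [hp0, hpb, hwe] at key
    simp only [Real.sqrt_zero, zero_div, Real.arctan_zero, mul_zero, zero_sub] at key
    refine key.trans ?_
    gcongr
    linarith
  · intro t ht
    have h1 : 4 * j ≤ 8 * (t - a) := by linarith [ht.1]
    have h2 : c - j ≤ c - t := by linarith [ht.2]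
    have h3 : 4 * j * (c - j) ≤ 8 * (t - a) * (c - t) :=
      mul_le_mul h1 h2 (by linarith) (by linarith)
    have hbt : 0 < b - t := by linarith [ht.2]
    have h4 : h ≤ Real.sqrt (24 * j) / (4 * j) * (8 * (t - a) * (c - t)) := by
      calc h ≤ Real.sqrt (24 * j) * (c - j) := hhc
        _ = Real.sqrt (24 * j) / (4 * j) * (4 * j * (c - j)) := by field_simp
        _ ≤ _ := by gcongr
    calc h ^ 2 * (b - t) = h * (b - t) * h := by ring
      _ ≤ h * (b - t) * (Real.sqrt (24 * j) / (4 * j) * (8 * (t - a) * (c - t))) := by gcongr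
      _ = _ := by ring
  · intro t ht
    have h1 : 0 < j + t := by linarith [ht.1]
    have h2 : 0 < j - t := by linarith [ht.2]
    have : -t / (j ^ 2 - t ^ 2) - 1 / 2 * ((-j - 3 * t) / (2 * (j ^ 2 - t ^ 2))) =
        1 / (4 * (j + t)) := by
      rw [show j ^ 2 - t ^ 2 = (j + t) * (j - t) by ring]
      field_simp
      ring
    rw [this, abs_of_pos (by positivity)]
    apply one_div_le_one_div_of_le hj
    linarith [ht.1]

lemma abs_phase_left_le {j h a b c : ℝ} (hj : 0 < j) (hh : 0 < h) (hsmall : h ^ 2 < 3 * j ^ 3)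
    (hab : a < b) (hbc : b < c)
    (ha : 8 * (a - j) ^ 2 * (a + j) - h ^ 2 = 0)
    (hb : 8 * (b - j) ^ 2 * (b + j) - h ^ 2 = 0)
    (hc : 8 * (c - j) ^ 2 * (c + j) - h ^ 2 = 0) :
    |(∫ t in a..0, (-h * t) / ((j ^ 2 - t ^ 2) *
        Real.sqrt (8 * (t - a) * (b - t) * (c - t)))) -
        Real.arctan (Real.sqrt (8 * j ^ 3 - h ^ 2) / h)| ≤
      1 / j * Real.sqrt (h ^ 2 / (4 * j ^ 2)) * (2 * Real.sqrt j) := by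
  obtain ⟨⟨a1, a2, b2, b1, c1, c2⟩, hfac⟩ := cubic_roots hj hh hsmall hab hbc ha hb hc
  have ha0 : a < 0 := by linarith
  obtain ⟨hwi, hwe⟩ := integral_rpow_neg_half_sub_left (a := a) (b := 0)
  have key := abs_phase_integral_sub_le (p := fun t => 8 * (t - a) * (b - t) * (c - t))
    (s := fun t => t - a) (c := 1) (E := 1 / j)
    (D := h ^ 2 / (4 * j ^ 2)) hh hfac a1 ha0 hj
    (fun t ht => mul_pos (mul_pos (by linarith [ht.1]) (by linarith [ht.2]))
      (by linarith [ht.2])) (fun t ht => by linarith [ht.1]) ?_ hwi ?_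
  · have hp0 : 8 * (0 - a) * (b - 0) * (c - 0) = 8 * j ^ 3 - h ^ 2 := by
      rw [hfac]; ring
    have hpa : 8 * (a - a) * (b - a) * (c - a) = 0 := by ring
    beta_reduce at key
    rw [hp0, hpa, hwe] at key
    simp only [Real.sqrt_zero, zero_div, Real.arctan_zero, mul_zero, sub_zero,
      one_mul] at key
    refine key.trans ?_
    gcongr
    linarith
  · intro t ht
    have hta : 0 < t - a := by linarith [ht.1]
    have h3 : j / 2 * j ≤ (b - t) * (c - t) :=
      mul_le_mul (by linarith [ht.2]) (by linarith [ht.2]) hj.le (by linarith [ht.2])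
    calc h ^ 2 * (t - a) = h ^ 2 / (4 * j ^ 2) * (8 * (t - a) * (j / 2 * j)) := by
          field_simp; ring
      _ ≤ h ^ 2 / (4 * j ^ 2) * (8 * (t - a) * ((b - t) * (c - t))) := by gcongr
      _ = _ := by ring
  · intro t ht
    have h1 : 0 < j + t := by linarith [ht.1]
    have h2 : 0 < j - t := by linarith [ht.2]
    have : -t / (j ^ 2 - t ^ 2) - 1 * ((-j - 3 * t) / (2 * (j ^ 2 - t ^ 2))) =
        1 / (2 * (j - t)) := by
      rw [show j ^ 2 - t ^ 2 = (j + t) * (j - t) by ring]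
      field_simp
      ring
    rw [this, abs_of_pos (by positivity)]
    apply one_div_le_one_div_of_le hj
    linarith [ht.2]

open Filter Topology in
lemma tendsto_arctan_sqrt_sub_div {A : ℝ} (hA : 0 < A) :
    Tendsto (fun h : ℝ => Real.arctan (Real.sqrt (A - h ^ 2) / h)) (𝓝[>] 0)
      (𝓝 (Real.pi / 2)) := by
  have h1 : Tendsto (fun h : ℝ => Real.sqrt (A - h ^ 2)) (𝓝[>] 0) (𝓝 (Real.sqrt A)) := by
    have : Continuous fun h : ℝ => Real.sqrt (A - h ^ 2) := by fun_prop
    simpa using (this.tendsto 0).mono_left nhdsWithin_le_nhds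
  have h2 := h1.pos_mul_atTop (Real.sqrt_pos.2 hA) tendsto_inv_nhdsGT_zero
  exact (tendsto_nhds_of_tendsto_nhdsWithin Real.tendsto_arctan_atTop).comp h2

open Filter Topology in
lemma tendsto_of_abs_sub_le {α : Type*} {l : Filter α} {f g e : α → ℝ} {x : ℝ}
    (hg : Tendsto g l (𝓝 x)) (he : Tendsto e l (𝓝 0)) (h : ∀ᶠ i in l, |f i - g i| ≤ e i) :
    Tendsto f l (𝓝 x) := by
  simpa using (squeeze_zero_norm' h he).add hg

/-- The contribution `φ₂` to the `S¹` reconstruction phase shift coming from the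
singularity of the reduced space:
`∫_{0}^{r₂(h)} (−ht)/((j² − t²)√(8(t − r₁)(r₂ − t)(r₃ − t))) dt → −π/4` as `h → 0⁺`;
consequently the total phase shift `φ = −2(φ₁ + φ₂)` tends to `−π/2` through `h > 0`
and to `+π/2` through `h < 0`, a phase jump of `π` across the homoclinic orbit. -/
theorem phase_contribution_singularity_and_total
    (j h₀ : ℝ) (hj : 0 < j) (hh₀ : 0 < h₀)
    (r₁ r₂ r₃ : ℝ → ℝ)
    (hroots : ∀ h : ℝ, 0 < h → h < h₀ →
      r₁ h < r₂ h ∧ r₂ h < r₃ h ∧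
      8 * (r₁ h - j) ^ 2 * (r₁ h + j) - h ^ 2 = 0 ∧
      8 * (r₂ h - j) ^ 2 * (r₂ h + j) - h ^ 2 = 0 ∧
      8 * (r₃ h - j) ^ 2 * (r₃ h + j) - h ^ 2 = 0) :
    Filter.Tendsto
      (fun h : ℝ => ∫ t in (0 : ℝ)..(r₂ h),
        (-h * t) /
          ((j ^ 2 - t ^ 2) *
            Real.sqrt (8 * (t - r₁ h) * (r₂ h - t) * (r₃ h - t))))
      (nhdsWithin 0 (Set.Ioi 0)) (nhds (-(Real.pi / 4))) ∧
    Filter.Tendsto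
      (fun h : ℝ => -2 *
        ((∫ t in (r₁ h)..0,
            (-h * t) /
              ((j ^ 2 - t ^ 2) *
                Real.sqrt (8 * (t - r₁ h) * (r₂ h - t) * (r₃ h - t)))) +
         (∫ t in (0 : ℝ)..(r₂ h),
            (-h * t) /
              ((j ^ 2 - t ^ 2) *
                Real.sqrt (8 * (t - r₁ h) * (r₂ h - t) * (r₃ h - t))))))
      (nhdsWithin 0 (Set.Ioi 0)) (nhds (-(Real.pi / 2))) ∧
    Filter.Tendsto
      (fun h : ℝ => -2 *
        ((∫ t in (r₁ (-h))..0,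
            (-h * t) /
              ((j ^ 2 - t ^ 2) *
                Real.sqrt (8 * (t - r₁ (-h)) * (r₂ (-h) - t) * (r₃ (-h) - t)))) +
         (∫ t in (0 : ℝ)..(r₂ (-h)),
            (-h * t) /
              ((j ^ 2 - t ^ 2) *
                Real.sqrt (8 * (t - r₁ (-h)) * (r₂ (-h) - t) * (r₃ (-h) - t))))))
      (nhdsWithin 0 (Set.Iio 0)) (nhds (Real.pi / 2)) := by
  have hsmall : ∀ᶠ h : ℝ in nhdsWithin 0 (Set.Ioi 0), 0 < h ∧ h < h₀ ∧ h ^ 2 < 3 * j ^ 3 := by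
    have h1 : ∀ᶠ h : ℝ in nhds 0, h ^ 2 < 3 * j ^ 3 :=
      (continuous_pow 2).continuousAt.eventually_lt_const (by simpa using by positivity)
    filter_upwards [self_mem_nhdsWithin, nhdsWithin_le_nhds (Iio_mem_nhds hh₀),
      nhdsWithin_le_nhds h1] with h a b c
    exact ⟨a, b, c⟩
  have harc := tendsto_arctan_sqrt_sub_div (A := 8 * j ^ 3) (by positivity)
  have hright := tendsto_of_abs_sub_le (f := fun h : ℝ => ∫ t in (0 : ℝ)..(r₂ h),
        (-h * t) / ((j ^ 2 - t ^ 2) *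
          Real.sqrt (8 * (t - r₁ h) * (r₂ h - t) * (r₃ h - t))))
    (e := fun h => 1 / j * Real.sqrt (h * (Real.sqrt (24 * j) / (4 * j))) * (2 * Real.sqrt j))
    (harc.const_mul (1 / 2)).neg
    (by
      have : Continuous fun h : ℝ =>
        1 / j * Real.sqrt (h * (Real.sqrt (24 * j) / (4 * j))) * (2 * Real.sqrt j) := by fun_prop
      simpa using (this.tendsto 0).mono_left nhdsWithin_le_nhds)
    (by
      filter_upwards [hsmall] with h hh
      obtain ⟨h12, h23, e1, e2, e3⟩ := hroots h hh.1 hh.2.1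
      exact abs_phase_right_le hj hh.1 hh.2.2 h12 h23 e1 e2 e3)
  have hleft := tendsto_of_abs_sub_le (f := fun h : ℝ => ∫ t in (r₁ h)..0,
        (-h * t) / ((j ^ 2 - t ^ 2) *
          Real.sqrt (8 * (t - r₁ h) * (r₂ h - t) * (r₃ h - t))))
    (e := fun h => 1 / j * Real.sqrt (h ^ 2 / (4 * j ^ 2)) * (2 * Real.sqrt j))
    harc
    (by
      have : Continuous fun h : ℝ =>
        1 / j * Real.sqrt (h ^ 2 / (4 * j ^ 2)) * (2 * Real.sqrt j) := by fun_prop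
      simpa using (this.tendsto 0).mono_left nhdsWithin_le_nhds)
    (by
      filter_upwards [hsmall] with h hh
      obtain ⟨h12, h23, e1, e2, e3⟩ := hroots h hh.1 hh.2.1
      exact abs_phase_left_le hj hh.1 hh.2.2 h12 h23 e1 e2 e3)
  have htotal := (hleft.add hright).const_mul (-2)
  have hneg : Filter.Tendsto (fun h : ℝ => -h) (nhdsWithin 0 (Set.Iio 0))
      (nhdsWithin 0 (Set.Ioi 0)) := by
    simpa using tendsto_neg_nhdsLT (a := (0 : ℝ))
  refine ⟨?_, ?_, ?_⟩
  · convert hright using 2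
    ring
  · convert htotal using 2
    ring
  · convert (htotal.comp hneg).neg using 2 with h
    · simp only [Function.comp_apply, neg_mul, neg_div, neg_neg, intervalIntegral.integral_neg]
      ring
    · ring
end
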